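/- Define h : [0,∞) → ℝ by h(t) = 0 for t ≤ 1, h(t) = t − 1 for 1 ≤ t ≤ 2, h(t) = 1 for t ≥ 2, and g : ℝ^{2×2} → ℝ by g(ξ) = max{h(|ξ|), arctan(det ξ)}, where |ξ| is the Frobenius norm. Then g is curl Young quasiconvex but g is not level convex, i.e., there exists c ∈ ℝ such that the sublevel set {ξ ∈ ℝ^{2×2} : g(ξ) ≤ c} is not convex. -/

import Mathlib

open MeasureTheory Filter Topology Bornology ZeroAtInfty NNReal ENNReal

noncomputable section

/-- A Young measure on `E`, parametrized over `(α, μ)`: a weakly* measurable family of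
probability measures. -/
def IsYoungMeasure {α E : Type*} [MeasurableSpace α] [MeasurableSpace E] [TopologicalSpace E]
    (μ : Measure α) (ν : α → Measure E) : Prop :=
  (∀ᵐ x ∂μ, IsProbabilityMeasure (ν x)) ∧
  ∀ φ : C₀(E, ℝ), Measurable fun x => ∫ ξ, φ ξ ∂(ν x)

/-- The sequence of measurable functions `z j` generates the Young measure `ν`:
for every `h ∈ L¹` and every `φ ∈ C₀`, `∫ h(x) φ(z_j(x)) dx → ∫ h(x) ⟨ν_x, φ⟩ dx`. -/
def GeneratesYM {α E : Type*} [MeasurableSpace α] [MeasurableSpace E] [TopologicalSpace E]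
    (μ : Measure α) (z : ℕ → α → E) (ν : α → Measure E) : Prop :=
  (∀ j, Measurable (z j)) ∧ IsYoungMeasure μ ν ∧
  ∀ h : α → ℝ, Integrable h μ → ∀ φ : C₀(E, ℝ),
    Tendsto (fun j => ∫ x, h x * φ (z j x) ∂μ) atTop
      (𝓝 (∫ x, h x * ∫ ξ, φ ξ ∂(ν x) ∂μ))

/-- The gradient matrix `∇u(x) ∈ ℝ^{d×N}` of `u : ℝ^N → ℝ^d`. -/
def gradMatrix {N d : ℕ} (u : (Fin N → ℝ) → (Fin d → ℝ)) (x : Fin N → ℝ) :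
    Fin d → Fin N → ℝ :=
  fun i j => fderiv ℝ u x (Pi.single j 1) i

/-- A `W^{1,∞}`-gradient Young measure on a set `Ω ⊆ ℝ^N`: a Young measure generated by the
gradients of a bounded sequence in `W^{1,∞}(Ω;ℝ^d)`. -/
def IsGradientYoungMeasure {N d : ℕ} (Ω : Set (Fin N → ℝ))
    (ν : (Fin N → ℝ) → Measure (Fin d → Fin N → ℝ)) : Prop :=
  ∃ u : ℕ → (Fin N → ℝ) → (Fin d → ℝ),
    (∃ C : ℝ≥0, ∀ j, LipschitzWith C (u j) ∧ ∀ x, ‖u j x‖ ≤ C) ∧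
    GeneratesYM (volume.restrict Ω) (fun j x => gradMatrix (u j) x) ν

/-- A homogeneous `W^{1,∞}`-gradient Young measure: a probability measure `ν₀` on `ℝ^{d×N}`
such that the constant family `ν_x = ν₀` is a gradient Young measure on some bounded
nonempty open set. -/
def IsHomogeneousGradientYM {N d : ℕ} (ν : Measure (Fin d → Fin N → ℝ)) : Prop :=
  IsProbabilityMeasure ν ∧ ∃ Ω : Set (Fin N → ℝ), IsOpen Ω ∧ Ω.Nonempty ∧ IsBounded Ω ∧
    IsGradientYoungMeasure Ω (fun _ => ν)

/-- `W : ℝ^{d×N} × ℝ^{d×N} → ℝ` is separately curl Young quasiconvex. -/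
def SeparatelyCurlYoungQuasiconvex {N d : ℕ}
    (W : (Fin d → Fin N → ℝ) → (Fin d → Fin N → ℝ) → ℝ) : Prop :=
  ∀ ν μ : Measure (Fin d → Fin N → ℝ),
    IsHomogeneousGradientYM ν → IsHomogeneousGradientYM μ →
    (W (∫ ξ, ξ ∂ν) (∫ ζ, ζ ∂μ) : EReal) ≤
      essSup (fun ξ => essSup (fun ζ => (W ξ ζ : EReal)) μ) ν


/-- `f : ℝ^{d×N} → ℝ` is curl Young quasiconvex: `f([ν]) ≤ ν-esssup f` for every homogeneous
`W^{1,∞}`-gradient Young measure `ν`. -/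
def CurlYoungQuasiconvex {N d : ℕ} (f : (Fin d → Fin N → ℝ) → ℝ) : Prop :=
  ∀ ν : Measure (Fin d → Fin N → ℝ), IsHomogeneousGradientYM ν →
    (f (∫ ξ, ξ ∂ν) : EReal) ≤ essSup (fun ξ => (f ξ : EReal)) ν

/-- The auxiliary function `h : h(t) = 0` for `t ≤ 1`, `h(t) = t - 1` for `1 ≤ t ≤ 2`,
`h(t) = 1` for `t ≥ 2`. -/
def hAux (t : ℝ) : ℝ := if t ≤ 1 then 0 else if t ≤ 2 then t - 1 else 1

/-- The Frobenius norm of a `2×2` matrix. -/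
def frobNorm (ξ : Fin 2 → Fin 2 → ℝ) : ℝ := Real.sqrt (∑ i, ∑ j, (ξ i j) ^ 2)

/-- The function `g(ξ) = max{h(|ξ|), arctan(det ξ)}` on `2×2` matrices. -/
def gAux (ξ : Fin 2 → Fin 2 → ℝ) : ℝ :=
  max (hAux (frobNorm ξ)) (Real.arctan (Matrix.det (Matrix.of ξ)))

/-- Line derivatives of Lipschitz functions: integrability against integrable functions. -/
lemma aux_int_lineDeriv_mul {z g : (Fin 2 → ℝ) → ℝ} {D : ℝ≥0} (hz : LipschitzWith D z)
    (hg : Integrable g) (a : Fin 2 → ℝ) : Integrable (fun x => lineDeriv ℝ z x a * g x) := by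
  refine hg.bdd_mul (c := D * ‖a‖) (aestronglyMeasurable_lineDeriv hz.continuous _) ?_
  exact .of_forall fun x => norm_lineDeriv_le_of_lipschitz ℝ hz

lemma aux_lineDeriv_zero {w : (Fin 2 → ℝ) → ℝ} {x : Fin 2 → ℝ} (hx : x ∉ tsupport w)
    (a : Fin 2 → ℝ) : lineDeriv ℝ w x a = 0 := by
  have h : w =ᶠ[𝓝 x] fun _ => 0 := notMem_tsupport_iff_eventuallyEq.1 hx
  rw [h.lineDeriv_eq]
  simp [lineDeriv]

lemma aux_int_lineDeriv {w : (Fin 2 → ℝ) → ℝ} {C : ℝ≥0} (hw : LipschitzWith C w)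
    (h'w : HasCompactSupport w) (a : Fin 2 → ℝ) : Integrable (fun x => lineDeriv ℝ w x a) := by
  have h1 : IntegrableOn (fun x => lineDeriv ℝ w x a) (tsupport w) :=
    (hw.locallyIntegrable_lineDeriv a).integrableOn_isCompact h'w
  refine (integrableOn_iff_integrable_of_support_subset ?_).1 h1
  intro x hx
  by_contra h
  exact hx (aux_lineDeriv_zero h a)

lemma aux_null {w z : (Fin 2 → ℝ) → ℝ} {C D : ℝ≥0} (hw : LipschitzWith C w)
    (h'w : HasCompactSupport w) (hz : LipschitzWith D z) (a b : Fin 2 → ℝ) :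
    ∫ x, lineDeriv ℝ w x a * lineDeriv ℝ z x b = ∫ x, lineDeriv ℝ w x b * lineDeriv ℝ z x a := by
  have wint : Integrable w := hw.continuous.integrable_of_hasCompactSupport h'w
  have A : Tendsto (fun (t : ℝ) ↦ ∫ x, (t⁻¹ • (z (x + t • b) - z x)) * lineDeriv ℝ w x a) (𝓝[>] 0)
      (𝓝 (∫ x, lineDeriv ℝ z x b * lineDeriv ℝ w x a)) :=
    hz.integral_inv_smul_sub_mul_tendsto_integral_lineDeriv_mul (aux_int_lineDeriv hw h'w a) b
  let K := Metric.cthickening (‖b‖) (tsupport w)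
  have K_compact : IsCompact K := IsCompact.cthickening h'w
  let g : (Fin 2 → ℝ) → ℝ := K.indicator (fun x => lineDeriv ℝ z x (-a))
  have hg : Integrable g := by
    rw [integrable_indicator_iff K_compact.measurableSet]
    exact (hz.locallyIntegrable_lineDeriv (-a)).integrableOn_isCompact K_compact
  have B := hw.integral_inv_smul_sub_mul_tendsto_integral_lineDeriv_mul hg (-b)
  have key : ∀ t ∈ Set.Ioc (0:ℝ) 1,
      ∫ x, (t⁻¹ • (z (x + t • b) - z x)) * lineDeriv ℝ w x a =
      ∫ x, (t⁻¹ • (w (x + t • (-b)) - w x)) * g x := by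
    intro t ht
    have S1 : ∀ x, (t⁻¹ • (w (x + t • (-b)) - w x)) * g x =
        t⁻¹ * (lineDeriv ℝ z x (-a) * w (x + t • (-b)) - lineDeriv ℝ z x (-a) * w x) := by
      intro x
      by_cases hx : x ∈ K
      · simp only [g, Set.indicator_of_mem hx, smul_eq_mul]; ring
      · have A : w x = 0 := by
          rw [← Function.notMem_support]
          contrapose hx
          exact Metric.self_subset_cthickening _ (subset_tsupport _ hx)
        have B : w (x + t • (-b)) = 0 := by
          rw [← Function.notMem_support]
          contrapose hx
          apply Metric.mem_cthickening_of_dist_le _ _ (‖b‖) (tsupport w) (subset_tsupport _ hx)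
          simp only [dist_eq_norm, sub_add_cancel_left, norm_neg, norm_smul, Real.norm_eq_abs,
            abs_of_nonneg ht.1.le]
          exact mul_le_of_le_one_left (norm_nonneg b) ht.2
        rw [A, B]; simp
    have w2 : LipschitzWith C (fun x => w (x + t • (-b))) := by
      have := hw.comp (LipschitzWith.id.add (LipschitzWith.const (t • (-b))))
      rw [add_zero, mul_one] at this
      exact this
    have w2c : HasCompactSupport (fun x => w (x + t • (-b))) :=
      h'w.comp_homeomorph (Homeomorph.addRight (t • (-b)))
    have w2i : Integrable (fun x => w (x + t • (-b))) :=
      w2.continuous.integrable_of_hasCompactSupport w2c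
    simp_rw [S1]
    rw [integral_const_mul, integral_sub (aux_int_lineDeriv_mul hz w2i _)
      (aux_int_lineDeriv_mul hz wint _), hz.integral_lineDeriv_mul_eq hw h'w,
      hz.integral_lineDeriv_mul_eq w2 w2c, neg_neg]
    have S2 : ∫ x, lineDeriv ℝ (fun x => w (x + t • (-b))) x a * z x =
        ∫ x, lineDeriv ℝ w x a * z (x + t • b) := by
      rw [← integral_add_right_eq_self _ (t • b)]
      congr 1
      ext x
      congr 1
      simp only [lineDeriv]
      congr 1
      ext s
      congr 1
      simp only [smul_neg]; abel
    have zc := hz.continuous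
    have dcs : HasCompactSupport (fun x => lineDeriv ℝ w x a) := by
      refine h'w.mono' ?_
      intro x hx
      by_contra h
      exact hx (aux_lineDeriv_zero h a)
    have int : ∀ y : (Fin 2 → ℝ) → ℝ, Continuous y →
        Integrable (fun x => lineDeriv ℝ w x a * y x) := by
      intro y hy
      have h1 : IntegrableOn (fun x => lineDeriv ℝ w x a * y x) (tsupport w) :=
        IntegrableOn.mul_continuousOn
          ((hw.locallyIntegrable_lineDeriv a).integrableOn_isCompact h'w) hy.continuousOn h'w
      refine (integrableOn_iff_integrable_of_support_subset ?_).1 h1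
      intro x hx
      by_contra h
      exact hx (by simp [aux_lineDeriv_zero h a])
    rw [S2, ← integral_sub (int _ (by fun_prop)) (int _ zc), ← integral_const_mul]
    congr 1
    ext x
    simp only [smul_eq_mul]; ring
  have B' : Tendsto (fun (t : ℝ) ↦ ∫ x, (t⁻¹ • (z (x + t • b) - z x)) * lineDeriv ℝ w x a) (𝓝[>] 0)
      (𝓝 (∫ x, lineDeriv ℝ w x (-b) * g x)) := by
    refine B.congr' ?_
    filter_upwards [Ioc_mem_nhdsGT zero_lt_one] with t ht
    exact (key t ht).symm
  have := tendsto_nhds_unique A B'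
  calc _ = ∫ x, lineDeriv ℝ z x b * lineDeriv ℝ w x a := by simp_rw [mul_comm]
    _ = _ := this
    _ = _ := by
      congr 1
      ext x
      rw [lineDeriv_neg]
      by_cases hx : x ∈ K
      · simp only [g, Set.indicator_of_mem hx, lineDeriv_neg]; ring
      · rw [aux_lineDeriv_zero (fun h => hx (Metric.self_subset_cthickening _ h))]; simp

lemma aux_lip_mul {f g : (Fin 2 → ℝ) → ℝ} {C D A B : ℝ≥0} (hf : LipschitzWith C f)
    (hg : LipschitzWith D g) (fb : ∀ x, ‖f x‖ ≤ A) (gb : ∀ x, ‖g x‖ ≤ B) :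
    LipschitzWith (C * B + A * D) (fun x => f x * g x) := by
  refine LipschitzWith.of_dist_le_mul fun x y => ?_
  have h1 := hf.dist_le_mul x y
  have h2 := hg.dist_le_mul x y
  rw [dist_eq_norm] at h1 h2 ⊢
  have e : f x * g x - f y * g y = (f x - f y) * g x + f y * (g x - g y) := by ring
  rw [e]
  calc _ ≤ ‖(f x - f y) * g x‖ + ‖f y * (g x - g y)‖ := norm_add_le _ _
    _ = ‖f x - f y‖ * ‖g x‖ + ‖f y‖ * ‖g x - g y‖ := by simp
    _ ≤ (C * dist x y) * B + A * (D * dist x y) := by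
      gcongr
      · exact gb x
      · exact fb y
    _ = _ := by push_cast; ring

/-- Integration by parts for the determinant. -/
lemma aux_det {p u z : (Fin 2 → ℝ) → ℝ} {C D P A B : ℝ≥0} (hp : LipschitzWith P p)
    (h'p : HasCompactSupport p) (hu : LipschitzWith C u) (hz : LipschitzWith D z)
    (pb : ∀ x, ‖p x‖ ≤ A) (ub : ∀ x, ‖u x‖ ≤ B) (a b : Fin 2 → ℝ) :
    ∫ x, p x * (lineDeriv ℝ u x a * lineDeriv ℝ z x b - lineDeriv ℝ u x b * lineDeriv ℝ z x a) =
    (∫ x, lineDeriv ℝ z x a * (u x * lineDeriv ℝ p x b)) -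
    ∫ x, lineDeriv ℝ z x b * (u x * lineDeriv ℝ p x a) := by
  have pint : Integrable p := hp.continuous.integrable_of_hasCompactSupport h'p
  have hw := aux_lip_mul hp hu pb ub
  have N := aux_null hw h'p.mul_right hz a b
  have prod : ∀ v, ∀ᵐ x : Fin 2 → ℝ, lineDeriv ℝ (fun x => p x * u x) x v =
      lineDeriv ℝ p x v * u x + p x * lineDeriv ℝ u x v := by
    intro v
    filter_upwards [hp.ae_lineDifferentiableAt (μ := volume) v,
      hu.ae_lineDifferentiableAt (μ := volume) v] with x h1 h2
    have := HasDerivAt.mul h1.hasLineDerivAt h2.hasLineDerivAt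
    simp only [zero_smul, add_zero] at this
    exact HasLineDerivAt.lineDeriv this
  have I1 : ∀ v v', Integrable (fun x => lineDeriv ℝ z x v * (u x * lineDeriv ℝ p x v')) := by
    intro v v'
    refine aux_int_lineDeriv_mul hz ?_ _
    exact (aux_int_lineDeriv hp h'p v').bdd_mul (c := B) hu.continuous.aestronglyMeasurable
      (.of_forall ub)
  have I2 : ∀ v v', Integrable (fun x => lineDeriv ℝ z x v * (lineDeriv ℝ u x v' * p x)) :=
    fun v v' => aux_int_lineDeriv_mul hz (aux_int_lineDeriv_mul hu pint _) _
  have E : ∀ v v', ∫ x, lineDeriv ℝ (fun x => p x * u x) x v * lineDeriv ℝ z x v' =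
      (∫ x, lineDeriv ℝ z x v' * (u x * lineDeriv ℝ p x v)) +
      ∫ x, lineDeriv ℝ z x v' * (lineDeriv ℝ u x v * p x) := by
    intro v v'
    rw [← integral_add (I1 _ _) (I2 _ _)]
    refine integral_congr_ae ?_
    filter_upwards [prod v] with x hx
    rw [hx]; ring
  rw [E, E] at N
  have F : ∫ x, p x * (lineDeriv ℝ u x a * lineDeriv ℝ z x b - lineDeriv ℝ u x b * lineDeriv ℝ z x a)
     = (∫ x, lineDeriv ℝ z x b * (lineDeriv ℝ u x a * p x)) -
      ∫ x, lineDeriv ℝ z x a * (lineDeriv ℝ u x b * p x) := by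
    rw [← integral_sub (I2 _ _) (I2 _ _)]
    congr 1; ext x; ring
  linarith

/-- Arzela-Ascoli: pointwise convergent subsequence on a compact set. -/
lemma aux_aa {u : ℕ → (Fin 2 → ℝ) → ℝ} {C B : ℝ≥0} (hu : ∀ j, LipschitzWith C (u j))
    (ub : ∀ j x, ‖u j x‖ ≤ B) {K : Set (Fin 2 → ℝ)} (hK : IsCompact K) :
    ∃ σ : ℕ → ℕ, StrictMono σ ∧ ∃ v : (Fin 2 → ℝ) → ℝ, ∀ x ∈ K,
      Tendsto (fun j => u (σ j) x) atTop (𝓝 (v x)) := by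
  have : CompactSpace K := isCompact_iff_compactSpace.1 hK
  let U : ℕ → BoundedContinuousFunction K ℝ := fun j =>
    BoundedContinuousFunction.mkOfCompact ⟨fun x => u j x, by
      have := (hu j).continuous; fun_prop⟩
  have H : IsCompact (closure (Set.range U)) := by
    refine BoundedContinuousFunction.arzela_ascoli (Metric.closedBall 0 B)
      (isCompact_closedBall _ _) _ ?_ ?_
    · rintro f x ⟨j, rfl⟩
      simpa [U] using ub j x
    · refine UniformEquicontinuous.equicontinuous ?_
      refine LipschitzWith.uniformEquicontinuous _ C ?_
      rintro ⟨_, j, rfl⟩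
      exact fun x y => hu j x y
  obtain ⟨f, -, σ, hσ, hf⟩ := H.tendsto_subseq (x := U) (fun j => subset_closure ⟨j, rfl⟩)
  classical
  refine ⟨σ, hσ, fun x => if h : x ∈ K then f ⟨x, h⟩ else 0, fun x hx => ?_⟩
  simp only [hx, dif_pos]
  exact ((continuous_eval_const (⟨x, hx⟩ : K)).tendsto f).comp hf

lemma aux_supp {Ω : Set (Fin 2 → ℝ)} (hΩ : IsOpen Ω) (hne : Ω.Nonempty) (hb : IsBounded Ω)
    {ν : Measure (Fin 2 → Fin 2 → ℝ)} [IsProbabilityMeasure ν]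
    {z : ℕ → (Fin 2 → ℝ) → (Fin 2 → Fin 2 → ℝ)}
    (hG : GeneratesYM (volume.restrict Ω) z (fun _ => ν)) {M : ℝ} (hz : ∀ j x, ‖z j x‖ ≤ M) :
    ∀ᵐ ξ ∂ν, ‖ξ‖ ≤ M := by
  have c1 : Continuous (fun ξ : Fin 2 → Fin 2 → ℝ => max 0 (‖ξ‖ - M) * Real.exp (-‖ξ‖)) := by
    fun_prop
  have t1 : Tendsto (fun ξ : Fin 2 → Fin 2 → ℝ => max 0 (‖ξ‖ - M) * Real.exp (-‖ξ‖))
      (cocompact _) (𝓝 0) := by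
    have t2 : Tendsto (fun s : ℝ => max 0 (s - M) * Real.exp (-s)) atTop (𝓝 0) := by
      have e1 : Tendsto (fun s : ℝ => s * Real.exp (-s) - M * Real.exp (-s)) atTop (𝓝 0) := by
        have a1 := Real.tendsto_pow_mul_exp_neg_atTop_nhds_zero 1
        have a2 := (Real.tendsto_pow_mul_exp_neg_atTop_nhds_zero 0).const_mul M
        simp only [pow_one, pow_zero, one_mul, mul_zero] at a1 a2
        simpa using a1.sub a2
      refine e1.congr' ?_
      filter_upwards [eventually_ge_atTop M] with s hs
      rw [max_eq_right (by linarith)]; ring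
    exact t2.comp (tendsto_norm_cocompact_atTop)
  let φ : C₀(Fin 2 → Fin 2 → ℝ, ℝ) := ⟨⟨_, c1⟩, t1⟩
  have φdef : ∀ ξ, φ ξ = max 0 (‖ξ‖ - M) * Real.exp (-‖ξ‖) := fun _ => rfl
  have fin : volume Ω ≠ ∞ := hb.measure_lt_top.ne
  have : IsFiniteMeasure (volume.restrict Ω) := ⟨by simpa using hb.measure_lt_top⟩
  have L := hG.2.2 (fun _ => 1) (integrable_const _) φ
  have z0 : ∀ j x, φ (z j x) = 0 := by
    intro j x
    rw [φdef, max_eq_left (by linarith [hz j x])]; simp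
  simp only [z0, mul_zero, integral_zero, one_mul] at L
  have h0 := tendsto_nhds_unique L tendsto_const_nhds
  rw [integral_const, smul_eq_mul] at h0
  have vpos : (volume.restrict Ω).real Set.univ ≠ 0 := by
    have : 0 < volume Ω := hΩ.measure_pos volume hne
    simp only [measureReal_def, Measure.restrict_apply_univ]
    exact (ENNReal.toReal_pos this.ne' fin).ne'
  have h1 : ∫ ξ, φ ξ ∂ν = 0 := (mul_eq_zero.1 h0).resolve_left vpos
  have φi : Integrable φ ν := φ.toBCF.integrable ν
  have φnn : 0 ≤ᵐ[ν] φ := .of_forall fun ξ => by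
    rw [φdef]; exact mul_nonneg (le_max_left _ _) (Real.exp_pos _).le
  have h2 := (integral_eq_zero_iff_of_nonneg_ae φnn φi).1 h1
  filter_upwards [h2] with ξ hξ
  by_contra hc
  push Not at hc
  have : 0 < φ ξ := by
    rw [φdef, max_eq_right (by linarith)]
    exact mul_pos (by linarith) (Real.exp_pos _)
  simp only [Pi.zero_apply] at hξ
  linarith

lemma aux_gen {Ω : Set (Fin 2 → ℝ)} (hΩ : IsOpen Ω) (hne : Ω.Nonempty) (hb : IsBounded Ω)
    {ν : Measure (Fin 2 → Fin 2 → ℝ)} [IsProbabilityMeasure ν]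
    {z : ℕ → (Fin 2 → ℝ) → (Fin 2 → Fin 2 → ℝ)}
    (hG : GeneratesYM (volume.restrict Ω) z (fun _ => ν)) {M : ℝ} (hz : ∀ j x, ‖z j x‖ ≤ M)
    {ψ : (Fin 2 → Fin 2 → ℝ) → ℝ} (hψ : Continuous ψ) {h : (Fin 2 → ℝ) → ℝ} (hh : Integrable h)
    (h0 : ∀ x ∉ Ω, h x = 0) :
    Tendsto (fun j => ∫ x, h x * ψ (z j x)) atTop (𝓝 ((∫ x, h x) * ∫ ξ, ψ ξ ∂ν)) := by
  have S := aux_supp hΩ hne hb hG hz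
  let χ : (Fin 2 → Fin 2 → ℝ) → ℝ := fun ξ => max 0 (min 1 (M + 1 - ‖ξ‖))
  have χ1 : ∀ ξ, ‖ξ‖ ≤ M → χ ξ = 1 := by
    intro ξ hξ
    simp only [χ]
    rw [min_eq_left (by linarith), max_eq_right zero_le_one]
  have χc : HasCompactSupport χ := by
    refine HasCompactSupport.intro (isCompact_closedBall 0 (M + 1)) ?_
    intro ξ hξ
    simp only [Metric.mem_closedBall, dist_zero_right, not_le] at hξ
    simp only [χ]
    rw [max_eq_left]
    exact (min_le_right _ _).trans (by linarith)
  have cont : Continuous (fun ξ => ψ ξ * χ ξ) := by simp only [χ]; fun_prop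
  let φ : C₀(Fin 2 → Fin 2 → ℝ, ℝ) := ⟨⟨_, cont⟩, (χc.mul_left).is_zero_at_infty⟩
  have φdef : ∀ ξ, φ ξ = ψ ξ * χ ξ := fun _ => rfl
  have L := hG.2.2 h hh.restrict φ
  have e1 : ∫ ξ, φ ξ ∂ν = ∫ ξ, ψ ξ ∂ν := by
    refine integral_congr_ae ?_
    filter_upwards [S] with ξ hξ
    rw [φdef, χ1 ξ hξ, mul_one]
  have e2 : ∀ j x, φ (z j x) = ψ (z j x) := fun j x => by rw [φdef, χ1 _ (hz j x), mul_one]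
  simp only [e1, e2, integral_mul_const] at L
  rw [setIntegral_eq_integral_of_forall_compl_eq_zero h0] at L
  refine L.congr fun j => ?_
  exact setIntegral_eq_integral_of_forall_compl_eq_zero fun x hx => by rw [h0 x hx, zero_mul]

lemma aux_integrable {ν : Measure (Fin 2 → Fin 2 → ℝ)} [IsProbabilityMeasure ν] {M : ℝ}
    (S : ∀ᵐ ξ ∂ν, ‖ξ‖ ≤ M) {F : Type*} [NormedAddCommGroup F]
    [SecondCountableTopology F] {ψ : (Fin 2 → Fin 2 → ℝ) → F}
    (hψ : Continuous ψ) : Integrable ψ ν := by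
  obtain ⟨B, hB⟩ := (isCompact_closedBall (0 : Fin 2 → Fin 2 → ℝ) M).exists_bound_of_continuousOn
    hψ.continuousOn
  refine Integrable.of_bound hψ.aestronglyMeasurable B ?_
  filter_upwards [S] with ξ hξ
  exact hB ξ (by simpa using hξ)

lemma aux_frob {ν : Measure (Fin 2 → Fin 2 → ℝ)} [IsProbabilityMeasure ν] {M : ℝ}
    (S : ∀ᵐ ξ ∂ν, ‖ξ‖ ≤ M) {R : ℝ} (hR : 0 ≤ R) (H : ∀ᵐ ξ ∂ν, frobNorm ξ ≤ R) :
    frobNorm (∫ ξ, ξ ∂ν) ≤ R := by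
  set F := ∫ ξ, ξ ∂ν with hF
  have ev : ∀ i j, ∫ ξ, ξ i j ∂ν = F i j := by
    intro i j
    let L : (Fin 2 → Fin 2 → ℝ) →L[ℝ] ℝ :=
      (ContinuousLinearMap.proj j).comp (ContinuousLinearMap.proj (R := ℝ) (φ := fun _ : Fin 2 => Fin 2 → ℝ) i)
    exact L.integral_comp_comm (aux_integrable S continuous_id)
  unfold frobNorm at *
  rw [Real.sqrt_le_left hR]
  have Q : ∀ᵐ ξ ∂ν, ∑ i, ∑ j, (2 * F i j * ξ i j - F i j ^ 2) ≤ R ^ 2 := by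
    filter_upwards [H] with ξ hξ
    rw [Real.sqrt_le_left hR] at hξ
    refine le_trans ?_ hξ
    refine Finset.sum_le_sum fun i _ => Finset.sum_le_sum fun j _ => ?_
    nlinarith [sq_nonneg (ξ i j - F i j)]
  have I := integral_mono_ae (aux_integrable S (by fun_prop)) (integrable_const _) Q
  rw [integral_const, probReal_univ, one_smul] at I
  refine le_trans (le_of_eq ?_) I
  rw [integral_finsetSum _ (fun i _ => aux_integrable S (by fun_prop))]
  refine Finset.sum_congr rfl fun i _ => ?_
  rw [integral_finsetSum _ (fun i _ => aux_integrable S (by fun_prop))]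
  refine Finset.sum_congr rfl fun j _ => ?_
  rw [integral_sub (aux_integrable S (by fun_prop)) (integrable_const _), integral_const_mul, ev]
  simp; ring

lemma aux_grad_bound {u : (Fin 2 → ℝ) → (Fin 2 → ℝ)} {C : ℝ≥0} (hu : LipschitzWith C u)
    (x : Fin 2 → ℝ) : ‖gradMatrix u x‖ ≤ C := by
  refine (pi_norm_le_iff_of_nonneg C.2).2 fun i => (pi_norm_le_iff_of_nonneg C.2).2 fun k => ?_
  calc ‖gradMatrix u x i k‖ ≤ ‖fderiv ℝ u x (Pi.single k 1)‖ := norm_le_pi_norm (fderiv ℝ u x (Pi.single k 1)) i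
    _ ≤ ‖fderiv ℝ u x‖ * ‖(Pi.single k 1 : Fin 2 → ℝ)‖ := ContinuousLinearMap.le_opNorm _ _
    _ ≤ C * 1 := by
      gcongr
      · exact norm_fderiv_le_of_lipschitz ℝ hu
      · rw [Pi.norm_single]; simp
    _ = C := mul_one _

lemma aux_grad_eq {u : (Fin 2 → ℝ) → (Fin 2 → ℝ)} {C : ℝ≥0} (hu : LipschitzWith C u) :
    ∀ᵐ x : Fin 2 → ℝ, ∀ i k,
      gradMatrix u x i k = lineDeriv ℝ (fun y => u y i) x (Pi.single k 1) := by
  filter_upwards [hu.ae_differentiableAt (μ := volume)] with x hx i k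
  have h1 : HasFDerivAt (fun y => u y i)
      ((ContinuousLinearMap.proj i : (Fin 2 → ℝ) →L[ℝ] ℝ).comp (fderiv ℝ u x)) x :=
    (hasFDerivAt_pi'.1 hx.hasFDerivAt) i
  rw [(h1.hasLineDerivAt (Pi.single k 1)).lineDeriv]
  rfl

lemma aux_comp_lip {u : (Fin 2 → ℝ) → (Fin 2 → ℝ)} {C : ℝ≥0} (hu : LipschitzWith C u)
    (i : Fin 2) : LipschitzWith C (fun y => u y i) :=
  LipschitzWith.of_dist_le_mul fun x y => (dist_le_pi_dist (u x) (u y) i).trans (hu.dist_le_mul x y)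

lemma aux_bump (a : Fin 2 → ℝ) (r : ℝ) (hr : 0 < r) : ∃ p : (Fin 2 → ℝ) → ℝ,
    LipschitzWith 1 p ∧ (∀ x, ‖p x‖ ≤ r.toNNReal) ∧ tsupport p ⊆ Metric.closedBall a r ∧
    HasCompactSupport p ∧ 0 < ∫ x, p x := by
  let p : (Fin 2 → ℝ) → ℝ := fun x => max 0 (r - dist x a)
  have pl : LipschitzWith 1 p := by
    refine LipschitzWith.of_dist_le_mul fun x y => ?_
    have h1 : |dist x a - dist y a| ≤ dist x y := abs_dist_sub_le x y a
    rw [Real.dist_eq]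
    simp only [p, NNReal.coe_one, one_mul]
    rw [abs_le] at h1 ⊢
    rcases max_cases 0 (r - dist x a) with ⟨e1, _⟩ | ⟨e1, _⟩ <;>
    rcases max_cases 0 (r - dist y a) with ⟨e2, _⟩ | ⟨e2, _⟩ <;>
    rw [e1, e2] <;> constructor <;> linarith [dist_nonneg (x := x) (y := y)]
  have ps : Function.support p ⊆ Metric.closedBall a r := by
    intro x hx
    by_contra h
    simp only [Metric.mem_closedBall, not_le] at h
    exact hx (max_eq_left (by linarith))
  have pt : tsupport p ⊆ Metric.closedBall a r :=
    closure_minimal ps Metric.isClosed_closedBall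
  have pc : HasCompactSupport p :=
    (isCompact_closedBall a r).of_isClosed_subset (isClosed_tsupport p) pt
  refine ⟨p, pl, ?_, pt, pc, ?_⟩
  · intro x
    rw [Real.coe_toNNReal _ hr.le, Real.norm_of_nonneg (le_max_left _ _)]
    exact max_le hr.le (by linarith [dist_nonneg (x := x) (y := a)])
  · refine pl.continuous.integral_pos_of_hasCompactSupport_nonneg_nonzero pc
      (fun x => le_max_left _ _) (x := a) ?_
    simp [p, hr.not_ge]

lemma aux_young_det {ν : Measure (Fin 2 → Fin 2 → ℝ)} (hν : IsHomogeneousGradientYM ν) :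
    (∃ M : ℝ, ∀ᵐ ξ ∂ν, ‖ξ‖ ≤ M) ∧
    ∫ ξ, (ξ 0 0 * ξ 1 1 - ξ 0 1 * ξ 1 0) ∂ν =
      (∫ ξ, ξ 0 0 ∂ν) * (∫ ξ, ξ 1 1 ∂ν) - (∫ ξ, ξ 0 1 ∂ν) * (∫ ξ, ξ 1 0 ∂ν) := by
  obtain ⟨hP, Ω, hΩ, hne, hb, u, ⟨C, hu⟩, hG⟩ := hν
  have hz : ∀ j x, ‖gradMatrix (u j) x‖ ≤ C := fun j x => aux_grad_bound (hu j).1 x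
  refine ⟨⟨C, aux_supp hΩ hne hb hG hz⟩, ?_⟩
  obtain ⟨a, ha⟩ := hne
  obtain ⟨r, hr, har⟩ := Metric.nhds_basis_closedBall.mem_iff.1 (hΩ.mem_nhds ha)
  obtain ⟨p, pl, pb, pt, pc, ppos⟩ := aux_bump a r hr
  have pint : Integrable p := pl.continuous.integrable_of_hasCompactSupport pc
  have cl : ∀ j i, LipschitzWith C (fun y => u j y i) := fun j i => aux_comp_lip (hu j).1 i
  have cb : ∀ j i x, ‖u j x i‖ ≤ C := fun j i x => (norm_le_pi_norm (u j x) i).trans ((hu j).2 x)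
  let e : Fin 2 → (Fin 2 → ℝ) := fun k => Pi.single k 1
  have ge : ∀ j, ∀ᵐ x : Fin 2 → ℝ, ∀ i k,
      gradMatrix (u j) x i k = lineDeriv ℝ (fun y => u j y i) x (e k) := fun j =>
    aux_grad_eq (hu j).1
  obtain ⟨σ, hσ, v, hv⟩ := aux_aa (fun j => cl j 0) (fun j => cb j 0) (isCompact_closedBall a r)
  have dp0 : ∀ x ∉ Metric.closedBall a r, ∀ l, lineDeriv ℝ p x (e l) = 0 := fun x hx l =>
    aux_lineDeriv_zero (fun h => hx (pt h)) _
  have gen : ∀ {ψ : (Fin 2 → Fin 2 → ℝ) → ℝ} (_ : Continuous ψ) {h : (Fin 2 → ℝ) → ℝ}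
      (_ : Integrable h) (_ : ∀ x ∉ Metric.closedBall a r, h x = 0),
      Tendsto (fun j => ∫ x, h x * ψ (gradMatrix (u (σ j)) x)) atTop
        (𝓝 ((∫ x, h x) * ∫ ξ, ψ ξ ∂ν)) := by
    intro ψ hψ h hh h0
    exact (aux_gen hΩ ⟨a, ha⟩ hb hG hz hψ hh (fun x hx => h0 x fun h => hx (har h))).comp
      hσ.tendsto_atTop
  have p0 : ∀ x ∉ Metric.closedBall a r, p x = 0 := fun x hx =>
    image_eq_zero_of_notMem_tsupport fun h => hx (pt h)
  -- pointwise convergence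
  have ptw : ∀ l x, Tendsto (fun j => u (σ j) x 0 * lineDeriv ℝ p x (e l)) atTop
      (𝓝 (v x * lineDeriv ℝ p x (e l))) := by
    intro l x
    by_cases hx : x ∈ Metric.closedBall a r
    · exact (hv x hx).mul_const _
    · simp [dp0 x hx]
  have dpi : ∀ l, Integrable (fun x => lineDeriv ℝ p x (e l)) := fun l => aux_int_lineDeriv pl pc _
  have ubd : ∀ l j x, ‖u (σ j) x 0 * lineDeriv ℝ p x (e l)‖ ≤ C * ‖lineDeriv ℝ p x (e l)‖ := by
    intro l j x
    rw [norm_mul]; gcongr; exact cb _ _ _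
  have vbd : ∀ l x, ‖v x * lineDeriv ℝ p x (e l)‖ ≤ C * ‖lineDeriv ℝ p x (e l)‖ := fun l x =>
    le_of_tendsto (ptw l x).norm (.of_forall fun j => ubd l j x)
  have um : ∀ l j, AEStronglyMeasurable (fun x => u (σ j) x 0 * lineDeriv ℝ p x (e l)) volume :=
    fun l j => (cl (σ j) 0).continuous.aestronglyMeasurable.mul (dpi l).aestronglyMeasurable
  have vm : ∀ l, AEStronglyMeasurable (fun x => v x * lineDeriv ℝ p x (e l)) volume := fun l =>
    aestronglyMeasurable_of_tendsto_ae atTop (um l) (.of_forall (ptw l))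
  have vi : ∀ l, Integrable (fun x => v x * lineDeriv ℝ p x (e l)) := fun l =>
    ((dpi l).norm.const_mul (C : ℝ)).mono' (vm l) (.of_forall (vbd l))
  have ui : ∀ l j, Integrable (fun x => u (σ j) x 0 * lineDeriv ℝ p x (e l)) := fun l j =>
    ((dpi l).norm.const_mul (C : ℝ)).mono' (um l j) (.of_forall (ubd l j))
  -- identification of the limit
  have V : ∀ l, ∫ x, v x * lineDeriv ℝ p x (e l) = - ((∫ x, p x) * ∫ ξ, ξ 0 l ∂ν) := by
    intro l
    have t1 : Tendsto (fun j => ∫ x, u (σ j) x 0 * lineDeriv ℝ p x (e l)) atTop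
        (𝓝 (∫ x, v x * lineDeriv ℝ p x (e l))) :=
      tendsto_integral_of_dominated_convergence _ (um l) ((dpi l).norm.const_mul (C : ℝ))
        (fun j => .of_forall (ubd l j)) (.of_forall (ptw l))
    have t2 := (gen (ψ := fun ξ => ξ 0 l) (by fun_prop) pint p0).neg
    refine tendsto_nhds_unique t1 (t2.congr fun j => ?_)
    have ibp := (cl (σ j) 0).integral_lineDeriv_mul_eq (μ := volume) pl pc (e l)
    have q1 : ∫ x, p x * gradMatrix (u (σ j)) x 0 l =
        ∫ x, lineDeriv ℝ (fun y => u (σ j) y 0) x (e l) * p x := by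
      refine integral_congr_ae ?_
      filter_upwards [ge (σ j)] with x hx
      rw [hx]; ring
    rw [q1, ibp, ← integral_neg]
    congr 1
    ext x
    rw [lineDeriv_neg]; ring
  have X : ∀ k l, Tendsto (fun j => ∫ x, lineDeriv ℝ (fun y => u (σ j) y 1) x (e k) *
      (u (σ j) x 0 * lineDeriv ℝ p x (e l))) atTop
      (𝓝 (- ((∫ x, p x) * ∫ ξ, ξ 0 l ∂ν) * ∫ ξ, ξ 1 k ∂ν)) := by
    intro k l
    have t1 : Tendsto (fun j => ∫ x, lineDeriv ℝ (fun y => u (σ j) y 1) x (e k) *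
      (u (σ j) x 0 * lineDeriv ℝ p x (e l) - v x * lineDeriv ℝ p x (e l))) atTop (𝓝 0) := by
      have bd : ∀ j x, ‖lineDeriv ℝ (fun y => u (σ j) y 1) x (e k)‖ ≤ C * ‖e k‖ := fun j x =>
        norm_lineDeriv_le_of_lipschitz ℝ (cl (σ j) 1)
      have := tendsto_integral_of_dominated_convergence (μ := volume)
        (F := fun j x => lineDeriv ℝ (fun y => u (σ j) y 1) x (e k) *
          (u (σ j) x 0 * lineDeriv ℝ p x (e l) - v x * lineDeriv ℝ p x (e l))) (f := fun _ => 0)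
        (fun x => (C * ‖e k‖) * (C * ‖lineDeriv ℝ p x (e l)‖ + C * ‖lineDeriv ℝ p x (e l)‖))
        (fun j => (aestronglyMeasurable_lineDeriv (cl (σ j) 1).continuous _).mul
          ((um l j).sub (vm l)))
        ((((dpi l).norm.const_mul (C : ℝ)).add ((dpi l).norm.const_mul (C : ℝ))).const_mul _)
        (fun j => .of_forall fun x => ?_) (.of_forall fun x => ?_)
      · simpa using this
      · rw [norm_mul]
        exact mul_le_mul (bd j x) ((norm_sub_le _ _).trans (add_le_add (ubd l j x) (vbd l x)))
          (norm_nonneg _) (by positivity)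
      · have s1 := (ptw l x).sub_const (v x * lineDeriv ℝ p x (e l))
        rw [sub_self] at s1
        have s2 := s1.norm.const_mul ((C : ℝ) * ‖e k‖)
        rw [norm_zero, mul_zero] at s2
        refine squeeze_zero_norm (fun j => ?_) s2
        rw [norm_mul]
        exact mul_le_mul_of_nonneg_right (bd j x) (norm_nonneg _)
    have t2 := gen (ψ := fun ξ => ξ 1 k) (by fun_prop) (vi l)
      (fun x hx => by simp [dp0 x hx])
    rw [V] at t2
    have t3 := t1.add t2
    rw [zero_add] at t3
    refine t3.congr fun j => ?_
    have q : ∫ x, v x * lineDeriv ℝ p x (e l) * gradMatrix (u (σ j)) x 1 k =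
        ∫ x, lineDeriv ℝ (fun y => u (σ j) y 1) x (e k) * (v x * lineDeriv ℝ p x (e l)) := by
      refine integral_congr_ae ?_
      filter_upwards [ge (σ j)] with x hx
      rw [hx]; ring
    have i1 : Integrable (fun x => lineDeriv ℝ (fun y => u (σ j) y 1) x (e k) *
        (u (σ j) x 0 * lineDeriv ℝ p x (e l) - v x * lineDeriv ℝ p x (e l))) :=
      aux_int_lineDeriv_mul (cl (σ j) 1) ((ui l j).sub (vi l)) _
    rw [q, ← integral_add i1
      (aux_int_lineDeriv_mul (cl (σ j) 1) (vi l) _)]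
    congr 1
    ext x
    ring
  have T1 := gen (ψ := fun ξ => ξ 0 0 * ξ 1 1 - ξ 0 1 * ξ 1 0) (by fun_prop) pint p0
  have T2 := (X 0 1).sub (X 1 0)
  have T3 := tendsto_nhds_unique T1 (T2.congr fun j => by
    rw [← aux_det pl pc (cl (σ j) 0) (cl (σ j) 1) pb (cb (σ j) 0) (e 0) (e 1)]
    refine integral_congr_ae ?_
    filter_upwards [ge (σ j)] with x hx
    simp only [hx])
  refine mul_left_cancel₀ ppos.ne' (T3.trans ?_)
  ring

lemma aux_hAux_nonneg (t : ℝ) : 0 ≤ hAux t := by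
  unfold hAux; split_ifs <;> linarith

lemma aux_hAux_le_one (t : ℝ) : hAux t ≤ 1 := by
  unfold hAux; split_ifs <;> linarith

lemma aux_hAux_le_iff {t c : ℝ} (h0 : 0 ≤ c) (hc : c < 1) : hAux t ≤ c ↔ t ≤ 1 + c := by
  unfold hAux; split_ifs <;> constructor <;> intro h <;> linarith

lemma aux_quasi : CurlYoungQuasiconvex gAux := by
  intro ν hν
  obtain ⟨⟨M, S⟩, hdet⟩ := aux_young_det hν
  have hP : IsProbabilityMeasure ν := hν.1
  have ae : ∀ᵐ ξ ∂ν, (gAux ξ : EReal) ≤ essSup (fun ξ => (gAux ξ : EReal)) ν :=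
    ae_le_essSup
  generalize essSup (fun ξ => (gAux ξ : EReal)) ν = s at ae
  obtain ⟨ξ₀, hξ₀⟩ := ae.exists
  induction s with
  | bot => simp at hξ₀
  | top => exact le_top
  | coe c =>
    simp only [EReal.coe_le_coe_iff] at *
    have c0 : 0 ≤ c := (aux_hAux_nonneg _).trans ((le_max_left _ _).trans hξ₀)
    set F := ∫ ξ, ξ ∂ν with hF
    have ev : ∀ i j, ∫ ξ, ξ i j ∂ν = F i j := by
      intro i j
      let L : (Fin 2 → Fin 2 → ℝ) →L[ℝ] ℝ := (ContinuousLinearMap.proj j).comp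
        (ContinuousLinearMap.proj (R := ℝ) (φ := fun _ : Fin 2 => Fin 2 → ℝ) i)
      exact L.integral_comp_comm (aux_integrable S continuous_id)
    refine max_le ?_ ?_
    · rcases lt_or_ge c 1 with h | h
      · rw [aux_hAux_le_iff c0 h]
        refine aux_frob S (by linarith) ?_
        filter_upwards [ae] with ξ hξ
        exact (aux_hAux_le_iff c0 h).1 ((le_max_left _ _).trans hξ)
      · exact (aux_hAux_le_one _).trans h
    · rcases lt_or_ge c (Real.pi / 2) with h | h
      · have hc : Real.arctan (Real.tan c) = c :=
          Real.arctan_tan (by linarith [Real.pi_pos]) h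
        rw [← hc, Real.arctan_le_arctan_iff, Matrix.det_fin_two]
        simp only [Matrix.of_apply]
        rw [← ev, ← ev, ← ev, ← ev, ← hdet]
        have : ∫ ξ, (ξ 0 0 * ξ 1 1 - ξ 0 1 * ξ 1 0) ∂ν ≤ ∫ _, Real.tan c ∂ν := by
          refine integral_mono_ae (aux_integrable S (by fun_prop)) (integrable_const _) ?_
          filter_upwards [ae] with ξ hξ
          have h1 : Real.arctan (Matrix.det (Matrix.of ξ)) ≤ c := (le_max_right _ _).trans hξ
          rw [← hc, Real.arctan_le_arctan_iff, Matrix.det_fin_two] at h1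
          simpa using h1
        simpa using this
      · exact (Real.arctan_lt_pi_div_two _).le.trans h

lemma aux_not_convex : ¬ Convex ℝ {ξ : Fin 2 → Fin 2 → ℝ | gAux ξ ≤ 1} := by
  intro H
  have hpi : 1 < Real.pi / 2 := by linarith [Real.pi_gt_three]
  have htan : 0 < Real.tan 1 := Real.tan_pos_of_pos_of_lt_pi_div_two one_pos hpi
  set t := Real.tan 1 + 1 with ht
  have m1 : (![![2 * t, 0], ![0, 0]] : Fin 2 → Fin 2 → ℝ) ∈
      {ξ : Fin 2 → Fin 2 → ℝ | gAux ξ ≤ 1} := by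
    refine max_le (aux_hAux_le_one _) ?_
    rw [Matrix.det_fin_two]; simp
  have m2 : (![![0, 0], ![0, 2 * t]] : Fin 2 → Fin 2 → ℝ) ∈
      {ξ : Fin 2 → Fin 2 → ℝ | gAux ξ ≤ 1} := by
    refine max_le (aux_hAux_le_one _) ?_
    rw [Matrix.det_fin_two]; simp
  have h := H m1 m2 (a := 1 / 2) (b := 1 / 2) (by norm_num) (by norm_num) (by norm_num)
  have h2 : Real.arctan _ ≤ 1 := (le_max_right _ _).trans h
  replace h2 := h2.trans_eq (Real.arctan_tan (x := 1) (by linarith) hpi).symm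
  rw [Real.arctan_le_arctan_iff, Matrix.det_fin_two] at h2
  simp at h2
  nlinarith

/-- **Example.**  The function `g(ξ) = max{h(|ξ|), arctan(det ξ)}` on `2×2` matrices is curl
Young quasiconvex, but it is not level convex: some sublevel set is not convex. -/
theorem example_curlYoungQuasiconvex_not_levelConvex :
    CurlYoungQuasiconvex gAux ∧
    ∃ c : ℝ, ¬ Convex ℝ {ξ : Fin 2 → Fin 2 → ℝ | gAux ξ ≤ c} := by
  exact ⟨aux_quasi, 1, aux_not_convex⟩

end
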